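/- Let ρ_AB be a bipartite density matrix such that the suprema defining C_HV(ρ_AB) and Δ_cl^→(ρ_AB) are both attained by complete projective measurements. Then C_HV(ρ_AB) = Δ_cl^→(ρ_AB) if and only if there exists a complete projective measurement {P_i} on A such that every P_i commutes with ρ_A and {P_i} attains both suprema, i.e. c_HV(ρ_AB,{P_i}) = C_HV(ρ_AB) and δ_cl^→(ρ_AB,{P_i}) = Δ_cl^→(ρ_AB). -/

import Mathlib

open Matrix Kronecker
open scoped ComplexOrder

noncomputable section

/-- von Neumann entropy (natural logarithm): `S(ρ) = -∑ λ_k log λ_k`. -/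
def vnEntropy {d : ℕ} (ρ : Matrix (Fin d) (Fin d) ℂ) : ℝ :=
  if h : ρ.IsHermitian then -∑ k, h.eigenvalues k * Real.log (h.eigenvalues k) else 0

/-- von Neumann entropy in bits (log base 2). -/
def vnEntropy2 {d : ℕ} (ρ : Matrix (Fin d) (Fin d) ℂ) : ℝ :=
  if h : ρ.IsHermitian then -∑ k, h.eigenvalues k * Real.logb 2 (h.eigenvalues k) else 0

/-- A density matrix: positive semidefinite with unit trace. -/
def IsDensityMatrix {n : Type} [Fintype n] [DecidableEq n] (ρ : Matrix n n ℂ) : Prop :=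
  ρ.PosSemidef ∧ ρ.trace = 1

/-- Partial trace over the B system. -/
def ptraceB {dA dB : ℕ} (ρ : Matrix (Fin dA × Fin dB) (Fin dA × Fin dB) ℂ) :
    Matrix (Fin dA) (Fin dA) ℂ :=
  Matrix.of fun a a' => ∑ b, ρ (a, b) (a', b)

/-- Partial trace over the A system. -/
def ptraceA {dA dB : ℕ} (ρ : Matrix (Fin dA × Fin dB) (Fin dA × Fin dB) ℂ) :
    Matrix (Fin dB) (Fin dB) ℂ :=
  Matrix.of fun b b' => ∑ a, ρ (a, b) (a, b')

/-- A projective measurement on `ℂ^{dA}`: a finite family of mutually orthogonal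
orthogonal projectors summing to the identity. -/
structure ProjMeas (dA m : ℕ) where
  P : Fin m → Matrix (Fin dA) (Fin dA) ℂ
  herm : ∀ i, (P i).IsHermitian
  idem : ∀ i, P i * P i = P i
  orth : ∀ i j, i ≠ j → P i * P j = 0
  sum_eq : ∑ i, P i = 1

/-- A measurement is complete if all projectors are rank one. -/
def ProjMeas.Complete {dA m : ℕ} (M : ProjMeas dA m) : Prop :=
  ∀ i, (M.P i).rank = 1

/-- Outcome probability `p_i = Tr[(P_i ⊗ 1) ρ]`. -/
def prob {dA dB m : ℕ} (ρ : Matrix (Fin dA × Fin dB) (Fin dA × Fin dB) ℂ)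
    (M : ProjMeas dA m) (i : Fin m) : ℝ :=
  (((M.P i ⊗ₖ (1 : Matrix (Fin dB) (Fin dB) ℂ)) * ρ).trace).re

/-- Conditional state of Bob: `Tr_A[(P_i ⊗ 1) ρ (P_i ⊗ 1)] / p_i`. -/
def condB {dA dB m : ℕ} (ρ : Matrix (Fin dA × Fin dB) (Fin dA × Fin dB) ℂ)
    (M : ProjMeas dA m) (i : Fin m) : Matrix (Fin dB) (Fin dB) ℂ :=
  ((prob ρ M i : ℂ))⁻¹ •
    ptraceA ((M.P i ⊗ₖ (1 : Matrix (Fin dB) (Fin dB) ℂ)) * ρ *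
      (M.P i ⊗ₖ (1 : Matrix (Fin dB) (Fin dB) ℂ)))

/-- `c_HV(ρ,{P_i}) = S(ρ_B) - ∑_i p_i S(ρ_i^B)`. -/
def cHV {dA dB m : ℕ} (ρ : Matrix (Fin dA × Fin dB) (Fin dA × Fin dB) ℂ)
    (M : ProjMeas dA m) : ℝ :=
  vnEntropy (ptraceA ρ) - ∑ i, prob ρ M i * vnEntropy (condB ρ M i)

/-- Same, in bits. -/
def cHV2 {dA dB m : ℕ} (ρ : Matrix (Fin dA × Fin dB) (Fin dA × Fin dB) ℂ)
    (M : ProjMeas dA m) : ℝ :=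
  vnEntropy2 (ptraceA ρ) - ∑ i, prob ρ M i * vnEntropy2 (condB ρ M i)

/-- Dephasing of a single-system state: `∑_i P_i σ P_i`. -/
def deph {d m : ℕ} (σ : Matrix (Fin d) (Fin d) ℂ) (M : ProjMeas d m) :
    Matrix (Fin d) (Fin d) ℂ :=
  ∑ i, M.P i * σ * M.P i

/-- `δ_cl^→(ρ,{P_i}) = S(ρ_A) - S(ρ'_A) + c_HV(ρ,{P_i})`. -/
def deltaCl {dA dB m : ℕ} (ρ : Matrix (Fin dA × Fin dB) (Fin dA × Fin dB) ℂ)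
    (M : ProjMeas dA m) : ℝ :=
  vnEntropy (ptraceB ρ) - vnEntropy (deph (ptraceB ρ) M) + cHV ρ M

/-- The Henderson–Vedral quantity: supremum of `c_HV` over complete projective measurements. -/
def CHV {dA dB : ℕ} (ρ : Matrix (Fin dA × Fin dB) (Fin dA × Fin dB) ℂ) : ℝ :=
  sSup {x : ℝ | ∃ m, ∃ M : ProjMeas dA m, M.Complete ∧ x = cHV ρ M}

/-- One-way classical information deficit: supremum of `δ_cl^→` over complete
projective measurements. -/
def DeltaCl {dA dB : ℕ} (ρ : Matrix (Fin dA × Fin dB) (Fin dA × Fin dB) ℂ) : ℝ :=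
  sSup {x : ℝ | ∃ m, ∃ M : ProjMeas dA m, M.Complete ∧ x = deltaCl ρ M}

/-- Alice-side dephasing of a bipartite state: `∑_i (P_i ⊗ 1) ρ (P_i ⊗ 1)`. -/
def dephAB {dA dB m : ℕ} (ρ : Matrix (Fin dA × Fin dB) (Fin dA × Fin dB) ℂ)
    (M : ProjMeas dA m) : Matrix (Fin dA × Fin dB) (Fin dA × Fin dB) ℂ :=
  ∑ i, (M.P i ⊗ₖ (1 : Matrix (Fin dB) (Fin dB) ℂ)) * ρ *
    (M.P i ⊗ₖ (1 : Matrix (Fin dB) (Fin dB) ℂ))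

/-- Outer product `|v⟩⟨v|`. -/
def outer {n : Type} [Fintype n] (v : n → ℂ) : Matrix n n ℂ :=
  Matrix.of fun x y => v x * star (v y)

theorem exists_eq_vecMulVec_of_rank_eq_one {d : ℕ} {P : Matrix (Fin d) (Fin d) ℂ}
    (h : P.rank = 1) : ∃ a b : Fin d → ℂ, P = vecMulVec a b := by
  obtain ⟨w, -, hw⟩ := finrank_eq_one_iff'.mp h
  have hcol : ∀ j, ∃ c : ℂ, c • (w : Fin d → ℂ) = P.col j := by
    intro j
    obtain ⟨c, hc⟩ := hw ⟨P.col j, ⟨Pi.single j 1, by simp⟩⟩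
    exact ⟨c, congrArg Subtype.val hc⟩
  choose c hc using hcol
  refine ⟨w, c, ?_⟩
  ext i j
  have := congrFun (hc j) i
  simp only [Pi.smul_apply, smul_eq_mul, col_apply] at this
  rw [vecMulVec_apply, ← this, mul_comm]

theorem mul_mul_eq_trace_smul {d : ℕ} {P : Matrix (Fin d) (Fin d) ℂ} (h : P.rank = 1)
    (X : Matrix (Fin d) (Fin d) ℂ) : P * X * P = (P * X).trace • P := by
  obtain ⟨a, b, rfl⟩ := exists_eq_vecMulVec_of_rank_eq_one h
  rw [vecMulVec_mul, vecMulVec_mul_vecMulVec, trace_vecMulVec, dotProduct_comm a]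
  ext i j
  simp [vecMulVec_apply, mul_left_comm]

theorem trace_eq_one_of_rank_eq_one {d : ℕ} {P : Matrix (Fin d) (Fin d) ℂ} (h : P.rank = 1)
    (hP : P * P = P) : P.trace = 1 := by
  have h1 := mul_mul_eq_trace_smul h P
  rw [hP, hP] at h1
  have hne : P ≠ 0 := by
    rintro rfl
    simp at h
  have h2 : (P.trace - 1) • P = 0 := by
    rw [sub_smul, ← h1, one_smul, sub_self]
  exact sub_eq_zero.mp ((smul_eq_zero.mp h2).resolve_right hne)

/-- The squared norm of the projection by `P` of the `k`-th eigenvector of `A`, for `P` an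
orthogonal projector. -/
def eigenOverlap {d : ℕ} {A : Matrix (Fin d) (Fin d) ℂ} (hA : A.IsHermitian)
    (P : Matrix (Fin d) (Fin d) ℂ) (k : Fin d) : ℝ :=
  (((hA.eigenvectorUnitary : Matrix (Fin d) (Fin d) ℂ)ᴴ * P *
    (hA.eigenvectorUnitary : Matrix (Fin d) (Fin d) ℂ)) k k).re

section Overlap

variable {d : ℕ} {A : Matrix (Fin d) (Fin d) ℂ}

theorem conjTranspose_eigenvectorUnitary_mul (hA : A.IsHermitian) :
    (hA.eigenvectorUnitary : Matrix (Fin d) (Fin d) ℂ)ᴴ *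
      (hA.eigenvectorUnitary : Matrix (Fin d) (Fin d) ℂ) = 1 :=
  Unitary.coe_star_mul_self hA.eigenvectorUnitary

theorem eigenvectorUnitary_mul_conjTranspose (hA : A.IsHermitian) :
    (hA.eigenvectorUnitary : Matrix (Fin d) (Fin d) ℂ) *
      (hA.eigenvectorUnitary : Matrix (Fin d) (Fin d) ℂ)ᴴ = 1 :=
  Unitary.coe_mul_star_self hA.eigenvectorUnitary

theorem mul_eigenvectorUnitary (hA : A.IsHermitian) :
    A * (hA.eigenvectorUnitary : Matrix (Fin d) (Fin d) ℂ) =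
      (hA.eigenvectorUnitary : Matrix (Fin d) (Fin d) ℂ) *
        diagonal (fun k => (hA.eigenvalues k : ℂ)) := by
  ext i k
  have := congrFun (hA.mulVec_eigenvectorBasis k) i
  rw [mul_diagonal, Matrix.IsHermitian.eigenvectorUnitary_apply, mul_apply]
  simp only [mulVec, dotProduct, Pi.smul_apply, Complex.real_smul] at this
  simp only [Matrix.IsHermitian.eigenvectorUnitary_apply]
  rw [this, mul_comm]

theorem eigenOverlap_eq_sum_normSq (hA : A.IsHermitian) {P : Matrix (Fin d) (Fin d) ℂ}
    (hP : P.IsHermitian) (hPP : P * P = P) (k : Fin d) :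
    eigenOverlap hA P k =
      ∑ j, Complex.normSq ((P * (hA.eigenvectorUnitary : Matrix (Fin d) (Fin d) ℂ)) j k) := by
  set U := (hA.eigenvectorUnitary : Matrix (Fin d) (Fin d) ℂ) with hU
  have h : Uᴴ * P * U = (P * U)ᴴ * (P * U) := by
    rw [conjTranspose_mul, hP.eq, Matrix.mul_assoc, Matrix.mul_assoc, ← Matrix.mul_assoc P P, hPP]
  rw [eigenOverlap, ← hU, h, mul_apply, Complex.re_sum]
  refine Finset.sum_congr rfl fun j _ => ?_
  rw [conjTranspose_apply, Complex.normSq_apply]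
  simp

theorem eigenOverlap_nonneg (hA : A.IsHermitian) {P : Matrix (Fin d) (Fin d) ℂ} (hP : P.IsHermitian)
    (hPP : P * P = P) (k : Fin d) : 0 ≤ eigenOverlap hA P k := by
  rw [eigenOverlap_eq_sum_normSq hA hP hPP]
  exact Finset.sum_nonneg fun _ _ => Complex.normSq_nonneg _

theorem sum_eigenOverlap (hA : A.IsHermitian) (P : Matrix (Fin d) (Fin d) ℂ) :
    ∑ k, eigenOverlap hA P k = P.trace.re := by
  simp only [eigenOverlap, ← Complex.re_sum]
  congr 1
  change trace _ = _
  rw [trace_mul_cycle, eigenvectorUnitary_mul_conjTranspose, Matrix.one_mul]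

theorem sum_eigenOverlap_mul_eigenvalues (hA : A.IsHermitian) (P : Matrix (Fin d) (Fin d) ℂ) :
    ∑ k, eigenOverlap hA P k * hA.eigenvalues k = (P * A).trace.re := by
  set U := (hA.eigenvectorUnitary : Matrix (Fin d) (Fin d) ℂ) with hU
  have h : (P * A).trace = (Uᴴ * P * U * diagonal (fun k => (hA.eigenvalues k : ℂ))).trace := by
    rw [Matrix.mul_assoc, ← mul_eigenvectorUnitary hA, ← hU, ← Matrix.mul_assoc,
      trace_mul_comm _ U, ← Matrix.mul_assoc, ← Matrix.mul_assoc, hU,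
      eigenvectorUnitary_mul_conjTranspose, Matrix.one_mul]
  rw [h, trace, Complex.re_sum]
  refine Finset.sum_congr rfl fun k _ => ?_
  rw [diag_apply, mul_diagonal, Complex.re_mul_ofReal]
  rfl

theorem sum_eigenOverlap_projMeas (hA : A.IsHermitian) {m : ℕ} (M : ProjMeas d m) (k : Fin d) :
    ∑ i, eigenOverlap hA (M.P i) k = 1 := by
  have h := congrArg (fun X : Matrix (Fin d) (Fin d) ℂ =>
    (((hA.eigenvectorUnitary : Matrix (Fin d) (Fin d) ℂ)ᴴ * X *
      (hA.eigenvectorUnitary : Matrix (Fin d) (Fin d) ℂ)) k k).re) M.sum_eq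
  simp only [Matrix.mul_one, conjTranspose_eigenvectorUnitary_mul, one_apply_eq,
    Complex.one_re, Matrix.mul_sum, Matrix.sum_mul, Matrix.sum_apply, Complex.re_sum] at h
  exact h

theorem mul_eq_smul_iff_eigenvalues_eq (hA : A.IsHermitian) {P : Matrix (Fin d) (Fin d) ℂ}
    (hP : P.IsHermitian) (hPP : P * P = P) (q : ℝ) :
    P * A = (q : ℂ) • P ↔ ∀ k, eigenOverlap hA P k ≠ 0 → hA.eigenvalues k = q := by
  set U := (hA.eigenvectorUnitary : Matrix (Fin d) (Fin d) ℂ) with hU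
  have hiff : P * A = (q : ℂ) • P ↔
      P * U * diagonal (fun k => (hA.eigenvalues k : ℂ)) = (q : ℂ) • (P * U) := by
    rw [Matrix.mul_assoc, ← mul_eigenvectorUnitary hA, ← hU, ← Matrix.mul_assoc, ← smul_mul]
    refine ⟨fun h => by rw [h], fun h => ?_⟩
    have := congrArg (· * Uᴴ) h
    simpa only [Matrix.mul_assoc, hU, eigenvectorUnitary_mul_conjTranspose, Matrix.mul_one]
      using this
  rw [hiff, ← Matrix.ext_iff]
  simp only [mul_diagonal, Matrix.smul_apply, smul_eq_mul]
  constructor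
  · intro h k hk
    rw [eigenOverlap_eq_sum_normSq hA hP hPP] at hk
    obtain ⟨j, -, hj⟩ := Finset.exists_ne_zero_of_sum_ne_zero hk
    have := h j k
    rw [mul_comm] at this
    exact_mod_cast mul_right_cancel₀ (fun h0 => hj (by rw [← hU, h0, map_zero])) this
  · intro h j k
    by_cases hk : eigenOverlap hA P k = 0
    · rw [eigenOverlap_eq_sum_normSq hA hP hPP,
        Finset.sum_eq_zero_iff_of_nonneg fun _ _ => Complex.normSq_nonneg _] at hk
      have := Complex.normSq_eq_zero.mp (hk j (Finset.mem_univ j))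
      rw [← hU] at this
      simp [this]
    · rw [h k hk, mul_comm]

theorem vnEntropy_eq_sum_negMulLog (hA : A.IsHermitian) :
    vnEntropy A = ∑ k, (hA.eigenvalues k).negMulLog := by
  rw [vnEntropy, dif_pos hA, ← Finset.sum_neg_distrib]
  exact Finset.sum_congr rfl fun k _ => by rw [Real.negMulLog, neg_mul]

theorem vnEntropy_eq_sum_sum_eigenOverlap (hA : A.IsHermitian) {m : ℕ} (M : ProjMeas d m) :
    vnEntropy A =
      ∑ i, ∑ k, eigenOverlap hA (M.P i) k * (hA.eigenvalues k).negMulLog := by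
  rw [vnEntropy_eq_sum_negMulLog hA, Finset.sum_comm]
  refine Finset.sum_congr rfl fun k _ => ?_
  rw [← Finset.sum_mul, sum_eigenOverlap_projMeas, one_mul]

theorem ProjMeas.Complete.sum_eigenOverlap (hA : A.IsHermitian) {m : ℕ} {M : ProjMeas d m}
    (hM : M.Complete) (i : Fin m) : ∑ k, eigenOverlap hA (M.P i) k = 1 := by
  rw [_root_.sum_eigenOverlap, trace_eq_one_of_rank_eq_one (hM i) (M.idem i), Complex.one_re]

theorem ProjMeas.Complete.vnEntropy_eq (hA : A.IsHermitian) {m : ℕ} {M : ProjMeas d m}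
    (hM : M.Complete) {q : Fin m → ℝ} (hq : ∀ i, M.P i * A = (q i : ℂ) • M.P i) :
    vnEntropy A = ∑ i, (q i).negMulLog := by
  rw [vnEntropy_eq_sum_sum_eigenOverlap hA M]
  refine Finset.sum_congr rfl fun i _ => ?_
  rw [← one_mul (q i).negMulLog, ← hM.sum_eigenOverlap hA i, Finset.sum_mul]
  refine Finset.sum_congr rfl fun k _ => ?_
  by_cases hk : eigenOverlap hA (M.P i) k = 0
  · rw [hk, zero_mul, zero_mul]
  · rw [(mul_eq_smul_iff_eigenvalues_eq hA (M.herm i) (M.idem i) (q i)).mp (hq i) k hk]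

theorem ProjMeas.Complete.proj_mul_deph (hA : A.IsHermitian) {m : ℕ} {M : ProjMeas d m}
    (hM : M.Complete) (i : Fin m) : M.P i * deph A M = (((M.P i * A).trace.re : ℝ) : ℂ) • M.P i := by
  have hreal : (((M.P i * A).trace.re : ℝ) : ℂ) = (M.P i * A).trace := by
    rw [← Complex.conj_eq_iff_re]
    change star _ = _
    rw [← trace_conjTranspose, conjTranspose_mul, hA.eq, (M.herm i).eq, trace_mul_comm]
  rw [hreal, ← mul_mul_eq_trace_smul (hM i), deph, Matrix.mul_sum,
    Finset.sum_eq_single i]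
  · rw [← Matrix.mul_assoc, ← Matrix.mul_assoc, M.idem]
  · intro j _ hj
    rw [← Matrix.mul_assoc, ← Matrix.mul_assoc, M.orth i j hj.symm, Matrix.zero_mul,
      Matrix.zero_mul]
  · simp

theorem isHermitian_deph (hA : A.IsHermitian) {m : ℕ} (M : ProjMeas d m) :
    (deph A M).IsHermitian := by
  rw [IsHermitian, deph, conjTranspose_sum]
  refine Finset.sum_congr rfl fun i _ => ?_
  rw [conjTranspose_mul, conjTranspose_mul, hA.eq, (M.herm i).eq, Matrix.mul_assoc]

theorem ProjMeas.Complete.vnEntropy_deph (hA : A.IsHermitian) {m : ℕ} {M : ProjMeas d m}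
    (hM : M.Complete) : vnEntropy (deph A M) = ∑ i, ((M.P i * A).trace.re).negMulLog :=
  hM.vnEntropy_eq (isHermitian_deph hA M) (hM.proj_mul_deph hA)

end Overlap

theorem sum_eigenOverlap_mul_negMulLog_le {d m : ℕ} {A : Matrix (Fin d) (Fin d) ℂ}
    (hA : A.PosSemidef) {M : ProjMeas d m} (hM : M.Complete) (i : Fin m) :
    ∑ k, eigenOverlap hA.1 (M.P i) k * (hA.1.eigenvalues k).negMulLog ≤
      ((M.P i * A).trace.re).negMulLog := by
  rw [← sum_eigenOverlap_mul_eigenvalues hA.1]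
  exact Real.concaveOn_negMulLog.le_map_sum
    (fun k _ => eigenOverlap_nonneg hA.1 (M.herm i) (M.idem i) k)
    (hM.sum_eigenOverlap hA.1 i) (fun k _ => hA.eigenvalues_nonneg k)

/-- A complete projective measurement does not decrease the entropy. -/
theorem vnEntropy_le_vnEntropy_deph {d m : ℕ} {A : Matrix (Fin d) (Fin d) ℂ}
    (hA : A.PosSemidef) {M : ProjMeas d m} (hM : M.Complete) :
    vnEntropy A ≤ vnEntropy (deph A M) := by
  rw [vnEntropy_eq_sum_sum_eigenOverlap hA.1 M, hM.vnEntropy_deph hA.1]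
  exact Finset.sum_le_sum fun i _ => sum_eigenOverlap_mul_negMulLog_le hA hM i

/-- A complete projective measurement preserving the entropy commutes with the state. -/
theorem commute_of_vnEntropy_deph_eq {d m : ℕ} {A : Matrix (Fin d) (Fin d) ℂ}
    (hA : A.PosSemidef) {M : ProjMeas d m} (hM : M.Complete)
    (h : vnEntropy A = vnEntropy (deph A M)) (i : Fin m) : M.P i * A = A * M.P i := by
  rw [vnEntropy_eq_sum_sum_eigenOverlap hA.1 M, hM.vnEntropy_deph hA.1,
    Finset.sum_eq_sum_iff_of_le fun i _ => sum_eigenOverlap_mul_negMulLog_le hA hM i] at h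
  have hi := h i (Finset.mem_univ i)
  rw [← sum_eigenOverlap_mul_eigenvalues hA.1] at hi
  have hev := (Real.strictConcaveOn_negMulLog.map_sum_eq_iff'
    (fun k _ => eigenOverlap_nonneg hA.1 (M.herm i) (M.idem i) k)
    (hM.sum_eigenOverlap hA.1 i) (fun k _ => hA.eigenvalues_nonneg k)).mp hi.symm
  have hPA := (mul_eq_smul_iff_eigenvalues_eq hA.1 (M.herm i) (M.idem i) _).mpr
    fun k hk => hev k (Finset.mem_univ k) hk
  have hAP := congrArg conjTranspose hPA
  rw [conjTranspose_mul, conjTranspose_smul, hA.1.eq, (M.herm i).eq,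
    show star (Complex.ofReal _) = _ from Complex.conj_ofReal _] at hAP
  exact hPA.trans hAP.symm

theorem deph_eq_self_of_commute {d m : ℕ} {A : Matrix (Fin d) (Fin d) ℂ} {M : ProjMeas d m}
    (h : ∀ i, M.P i * A = A * M.P i) : deph A M = A := by
  simp only [deph, h, Matrix.mul_assoc, M.idem]
  rw [← Matrix.mul_sum, M.sum_eq, Matrix.mul_one]

theorem vnEntropy_nonneg {d : ℕ} {A : Matrix (Fin d) (Fin d) ℂ} (hA : IsDensityMatrix A) :
    0 ≤ vnEntropy A := by
  obtain ⟨hA, htr⟩ := hA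
  rw [vnEntropy_eq_sum_negMulLog hA.1]
  refine Finset.sum_nonneg fun k _ =>
    Real.negMulLog_nonneg (hA.eigenvalues_nonneg k) ?_
  have hsum : ∑ k, hA.1.eigenvalues k = 1 := by
    rw [hA.1.trace_eq_sum_eigenvalues] at htr
    exact Complex.ofReal_injective (by rw [Complex.ofReal_sum]; exact htr)
  rw [← hsum]
  exact Finset.single_le_sum (fun j _ => hA.eigenvalues_nonneg j) (Finset.mem_univ k)

section PartialTrace

variable {dA dB : ℕ} {ρ : Matrix (Fin dA × Fin dB) (Fin dA × Fin dB) ℂ}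

theorem posSemidef_ptraceA (hρ : ρ.PosSemidef) : (ptraceA ρ).PosSemidef := by
  have h : ptraceA ρ = ∑ a, ρ.submatrix (fun b => (a, b)) (fun b => (a, b)) := by
    ext b b'
    simp [ptraceA, Matrix.sum_apply]
  rw [h]
  exact posSemidef_sum _ fun a _ => hρ.submatrix _

theorem posSemidef_ptraceB (hρ : ρ.PosSemidef) : (ptraceB ρ).PosSemidef := by
  have h : ptraceB ρ = ∑ b, ρ.submatrix (fun a => (a, b)) (fun a => (a, b)) := by
    ext a a'
    simp [ptraceB, Matrix.sum_apply]
  rw [h]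
  exact posSemidef_sum _ fun b _ => hρ.submatrix _

theorem trace_ptraceA : (ptraceA ρ).trace = ρ.trace := by
  simp only [trace, diag_apply, ptraceA, of_apply, Fintype.sum_prod_type]
  exact Finset.sum_comm

theorem prob_mul_vnEntropy_condB_nonneg (hρ : ρ.PosSemidef) {m : ℕ} (M : ProjMeas dA m)
    (i : Fin m) : 0 ≤ prob ρ M i * vnEntropy (condB ρ M i) := by
  set K := M.P i ⊗ₖ (1 : Matrix (Fin dB) (Fin dB) ℂ) with hK
  have hKH : Kᴴ = K := by rw [hK, conjTranspose_kronecker, (M.herm i).eq, conjTranspose_one]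
  have hKK : K * K = K := by rw [hK, ← mul_kronecker_mul, M.idem, Matrix.one_mul]
  have hpsd : (K * ρ * K).PosSemidef := by
    have := hρ.mul_mul_conjTranspose_same K
    rwa [hKH] at this
  have htr : (K * ρ * K).trace = (K * ρ).trace := by
    rw [trace_mul_comm, ← Matrix.mul_assoc, hKK]
  have h0 : 0 ≤ (K * ρ).trace := htr ▸ hpsd.trace_nonneg
  have hp : (prob ρ M i : ℂ) = (K * ρ).trace := (Complex.eq_re_of_ofReal_le h0).symm
  have hp0 : 0 ≤ prob ρ M i := (Complex.nonneg_iff.mp h0).1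
  rcases hp0.eq_or_lt with hz | hpos
  · rw [← hz, zero_mul]
  · refine mul_nonneg hp0 (vnEntropy_nonneg ⟨?_, ?_⟩)
    · exact (posSemidef_ptraceA hpsd).smul (inv_nonneg.mpr (Complex.zero_le_real.mpr hp0))
    · rw [condB, trace_smul, trace_ptraceA, ← hK, htr, ← hp, smul_eq_mul]
      exact inv_mul_cancel₀ (Complex.ofReal_ne_zero.mpr hpos.ne')

theorem cHV_le_vnEntropy (hρ : ρ.PosSemidef) {m : ℕ} (M : ProjMeas dA m) :
    cHV ρ M ≤ vnEntropy (ptraceA ρ) :=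
  sub_le_self _ (Finset.sum_nonneg fun i _ => prob_mul_vnEntropy_condB_nonneg hρ M i)

theorem cHV_le_CHV (hρ : ρ.PosSemidef) {m : ℕ} {M : ProjMeas dA m} (hM : M.Complete) :
    cHV ρ M ≤ CHV ρ := by
  refine le_csSup ⟨vnEntropy (ptraceA ρ), ?_⟩ ⟨m, M, hM, rfl⟩
  rintro _ ⟨n, N, -, rfl⟩
  exact cHV_le_vnEntropy hρ N

end PartialTrace

/-- Lemma 1: if the suprema defining `C_HV` and `Δ_cl^→` are attained,
then `C_HV(ρ) = Δ_cl^→(ρ)` iff there is a complete projective measurement whose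
projectors commute with `ρ_A` attaining both suprema. -/
theorem CHV_eq_DeltaCl_iff {dA dB : ℕ}
    (ρ : Matrix (Fin dA × Fin dB) (Fin dA × Fin dB) ℂ) (hρ : IsDensityMatrix ρ)
    (hattC : ∃ (m : ℕ) (M : ProjMeas dA m), M.Complete ∧ cHV ρ M = CHV ρ)
    (hattD : ∃ (m : ℕ) (M : ProjMeas dA m), M.Complete ∧ deltaCl ρ M = DeltaCl ρ) :
    CHV ρ = DeltaCl ρ ↔
      ∃ (m : ℕ) (M : ProjMeas dA m), M.Complete ∧
        (∀ i, M.P i * ptraceB ρ = ptraceB ρ * M.P i) ∧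
        cHV ρ M = CHV ρ ∧ deltaCl ρ M = DeltaCl ρ := by
  constructor
  · intro h
    obtain ⟨m, M, hM, hD⟩ := hattD
    have hA := posSemidef_ptraceB hρ.1
    have hc := cHV_le_CHV hρ.1 hM
    have hS := vnEntropy_le_vnEntropy_deph hA hM
    have hδ : deltaCl ρ M =
      vnEntropy (ptraceB ρ) - vnEntropy (deph (ptraceB ρ) M) + cHV ρ M := rfl
    exact ⟨m, M, hM, commute_of_vnEntropy_deph_eq hA hM (by linarith), by linarith, hD⟩
  · rintro ⟨m, M, -, hcomm, hC, hD⟩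
    rw [← hC, ← hD, deltaCl, deph_eq_self_of_commute hcomm, sub_self, zero_add]

end
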